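/- arXiv:1508.00607 — 4 statements merged into one kernel-verified Lean document; each statement's English description precedes it below -/
import Mathlib

section
/- Let Q be an asymmetric, transitive relation on a set X. Then there exists a family {Q_α}_{α ∈ I} of relations on X, each of which is asymmetric and negatively transitive, such that Q = ⋂_{α ∈ I} Q_α. -/
universe u

/-- A strict partial order extends to a strict weak order avoiding any prescribed pair outside
the original relation. -/
theorem exists_strictWeakOrder_extension_not_mem {X : Type u} {Q : Set (X × X)}
    (hasym : ∀ x y : X, (x, y) ∈ Q → (y, x) ∉ Q)
    (htrans : ∀ x y z : X, (x, y) ∈ Q → (y, z) ∈ Q → (x, z) ∈ Q)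
    {a b : X} (hab : (a, b) ∉ Q) :
    ∃ W : Set (X × X),
      ((∀ x y : X, (x, y) ∈ W → (y, x) ∉ W) ∧
        (∀ x y z : X, (x, y) ∉ W → (y, z) ∉ W → (x, z) ∉ W)) ∧
      Q ⊆ W ∧ (a, b) ∉ W := by
  let le : X → X → Prop := fun x y => x = y ∨ (x, y) ∈ Q
  have le_trans' : ∀ {x y z}, le x y → le y z → le x z := by
    rintro x y z (rfl | hxy) (rfl | hyz)
    · exact Or.inl rfl
    · exact Or.inr hyz
    · exact Or.inr hxy
    · exact Or.inr (htrans _ _ _ hxy hyz)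
  have le_antisymm' : ∀ {x y}, le x y → le y x → x = y := by
    rintro x y (rfl | hxy) (h | hyx)
    · rfl
    · rfl
    · exact h.symm
    · exact (hasym _ _ hxy hyx).elim
  have eq_of_le : le a b → a = b := fun h => h.resolve_right hab
  let r : X → X → Prop := fun x y => le x y ∨ (le x b ∧ le a y)
  have hr : IsPartialOrder X r :=
    { refl := fun x => Or.inl (Or.inl rfl)
      trans := by
        rintro x y z (hxy | ⟨hxb, hay⟩) (hyz | ⟨hyb, haz⟩)
        · exact Or.inl (le_trans' hxy hyz)
        · exact Or.inr ⟨le_trans' hxy hyb, haz⟩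
        · exact Or.inr ⟨hxb, le_trans' hay hyz⟩
        · exact Or.inr ⟨hxb, haz⟩
      antisymm := by
        rintro x y (hxy | ⟨hxb, hay⟩) (hyx | ⟨hyb, hax⟩)
        · exact le_antisymm' hxy hyx
        · obtain rfl := eq_of_le (le_trans' hax (le_trans' hxy hyb))
          exact le_antisymm' hxy (le_trans' hyb hax)
        · obtain rfl := eq_of_le (le_trans' hay (le_trans' hyx hxb))
          exact le_antisymm' (le_trans' hxb hay) hyx
        · obtain rfl := eq_of_le (le_trans' hay hyb)
          exact le_antisymm' (le_trans' hxb hay) (le_trans' hyb hax) }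
  obtain ⟨s, hs, hrs⟩ := extend_partialOrder r
  refine ⟨{p | ¬ s p.2 p.1}, ⟨fun x y hxy hyx => ?_, fun x y z hxy hyz hxz => ?_⟩, ?_, ?_⟩
  · exact (hs.total x y).elim hyx hxy
  · exact hxz (hs.trans _ _ _ (not_not.mp hyz) (not_not.mp hxy))
  · rintro ⟨x, y⟩ hxy hyx
    obtain rfl := hs.antisymm _ _ (hrs _ _ (Or.inl (Or.inr hxy))) hyx
    exact hasym _ _ hxy hxy
  · exact not_not.mpr (hrs _ _ (Or.inr ⟨Or.inl rfl, Or.inl rfl⟩))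

/-- Every asymmetric transitive relation is the intersection of a family of
asymmetric, negatively transitive relations. -/
theorem strict_order_realization {X : Type u} (Q : Set (X × X))
    (hasym : ∀ x y : X, (x, y) ∈ Q → (y, x) ∉ Q)
    (htrans : ∀ x y z : X, (x, y) ∈ Q → (y, z) ∈ Q → (x, z) ∈ Q) :
    ∃ (I : Type u) (Qa : I → Set (X × X)),
      (∀ α : I,
        (∀ x y : X, (x, y) ∈ Qa α → (y, x) ∉ Qa α) ∧
        (∀ x y z : X, (x, y) ∉ Qa α → (y, z) ∉ Qa α → (x, z) ∉ Qa α)) ∧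
      (Q = ⋂ α : I, Qa α) := by
  choose! W hW hQW hnot using
    fun (p : X × X) (hp : p ∉ Q) =>
      exists_strictWeakOrder_extension_not_mem hasym htrans (a := p.1) (b := p.2) hp
  refine ⟨{p : X × X // p ∉ Q}, fun p => W p, fun p => hW p p.2, ?_⟩
  refine Set.Subset.antisymm (Set.subset_iInter fun p => hQW p p.2) fun p hp => ?_
  by_contra hpQ
  exact hnot p hpQ (Set.mem_iInter.mp hp ⟨p, hpQ⟩)
end

section
/- Fix ε > 0. Define f : ℝ → ℝ by f(x) = x + (1 − x²)·χ(x), where χ is the indicator function of the open interval (−1, 1) (so f(x) = x + 1 − x² for |x| < 1 and f(x) = x otherwise), and for each α ∈ ℝ define v_α : ℝ → ℝ by v_α(x) = f((x − α)/ε). Then each v_α is continuous, and for all x, y ∈ ℝ: x + ε ≥ y if and only if there exists α ∈ ℝ with v_α(x) ≥ v_α(y). -/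
noncomputable section

/-- `f(x) = x + (1 - x²)·χ(x)` where `χ` is the indicator of `(-1, 1)`. -/
def luceF (x : ℝ) : ℝ := x + (1 - x ^ 2) * Set.indicator (Set.Ioo (-1 : ℝ) 1) 1 x

/-- The family `v_α(x) = f((x - α)/ε)`. -/
def luceV (ε α x : ℝ) : ℝ := luceF ((x - α) / ε)

theorem luceF_eq_add_max (x : ℝ) : luceF x = x + max 0 (1 - x ^ 2) := by
  unfold luceF
  by_cases h : x ∈ Set.Ioo (-1 : ℝ) 1
  · rw [Set.indicator_of_mem h, Pi.one_apply, mul_one, max_eq_right]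
    nlinarith [h.1, h.2]
  · rw [Set.indicator_of_notMem h, mul_zero, max_eq_left]
    by_contra! hx
    exact h ⟨by nlinarith, by nlinarith⟩

theorem continuous_luceF : Continuous luceF := by
  simp only [funext luceF_eq_add_max]
  fun_prop

theorem luceF_one : luceF 1 = 1 := by simp [luceF]

theorem one_le_luceF {a : ℝ} (ha : 0 ≤ a) : 1 ≤ luceF a := by
  rw [luceF_eq_add_max]
  rcases le_total a 1 with h | h
  · nlinarith [le_max_right 0 (1 - a ^ 2)]
  · linarith [le_max_left 0 (1 - a ^ 2)]

theorem luceF_lt_luceF {a b : ℝ} (h : a + 1 < b) : luceF a < luceF b := by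
  simp only [luceF_eq_add_max]
  have hb₀ := le_max_left 0 (1 - b ^ 2)
  have hb₁ := le_max_right 0 (1 - b ^ 2)
  rcases max_cases 0 (1 - a ^ 2) with ⟨ha, _⟩ | ⟨ha, _⟩ <;> rw [ha]
  · linarith
  · rcases le_or_gt 0 a with h₀ | h₀
    · nlinarith
    · rcases le_or_gt 1 b with h₁ | h₁ <;> nlinarith

/-- Example 1: the family `{v_α}` is a continuous multi-utility representation of
the semiorder `x + ε ≥ y`. -/
theorem semiorder_continuous_representation (ε : ℝ) (hε : 0 < ε) :
    (∀ α : ℝ, Continuous (luceV ε α)) ∧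
    (∀ x y : ℝ, x + ε ≥ y ↔ ∃ α : ℝ, luceV ε α x ≥ luceV ε α y) := by
  refine ⟨fun α => continuous_luceF.comp (by fun_prop), fun x y => ⟨fun h => ⟨y - ε, ?_⟩, ?_⟩⟩
  · have hy : (y - (y - ε)) / ε = 1 := by rw [sub_sub_cancel, div_self hε.ne']
    simp only [luceV, hy, luceF_one]
    exact one_le_luceF (div_nonneg (by linarith) hε.le)
  · rintro ⟨α, hα⟩
    by_contra! h
    refine absurd hα (not_le.mpr (luceF_lt_luceF ?_))
    rw [div_add_one hε.ne']
    gcongr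
    linarith
end
end

section
/- Let P be a relation on a set X and let Q = {(x,y) ∈ X × X : (y,x) ∉ P}. Then P is complete and negatively transitive if and only if there exists a family V of functions X → ℝ such that for all x, y ∈ X: (x,y) ∈ Q if and only if (v(x) ≥ v(y) for every v ∈ V) and (v(x) > v(y) for some v ∈ V). -/
/-- Non-continuous Pareto embedding theorem: `P` is complete and negatively
transitive iff its strict part `Q` admits a Pareto multi-utility
representation. -/
theorem pareto_embedding {X : Type*} (P : Set (X × X)) (Q : Set (X × X))
    (hQ : Q = {p : X × X | (p.2, p.1) ∉ P}) :
    ((∀ x y : X, (x, y) ∈ P ∨ (y, x) ∈ P) ∧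
      (∀ x y z : X, (x, y) ∉ P → (y, z) ∉ P → (x, z) ∉ P)) ↔
    ∃ V : Set (X → ℝ), ∀ x y : X,
      (x, y) ∈ Q ↔ (∀ v ∈ V, v x ≥ v y) ∧ (∃ v ∈ V, v x > v y) := by
  classical
  subst hQ
  simp only [Set.mem_ofPred_eq]
  constructor
  · rintro ⟨hc, hn⟩
    have irrefl (x : X) : (x, x) ∈ P := (hc x x).elim id id
    refine ⟨Set.range fun z x => if x = z ∨ (z, x) ∉ P then (1 : ℝ) else 0, fun x y => ?_⟩
    simp only [Set.forall_mem_range, Set.exists_range_iff]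
    constructor
    · intro hxy
      refine ⟨fun z => ?_, x, ?_⟩
      · have mono : (y = z ∨ (z, y) ∉ P) → (x = z ∨ (z, x) ∉ P) := by
          rintro (rfl | h)
          · exact Or.inr hxy
          · exact Or.inr (hn z y x h hxy)
        by_cases h : y = z ∨ (z, y) ∉ P
        · simp only [if_pos h, if_pos (mono h), ge_iff_le, le_refl]
        · rw [if_neg h]
          split_ifs <;> norm_num
      · have hne : y ≠ x := by
          rintro rfl
          exact hxy (irrefl y)
        have hyx : (x, y) ∈ P := (hc x y).resolve_right hxy
        simp [hne, hyx]
    · rintro ⟨hle, z, hlt⟩ hP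
      have hxy := hle y
      have hne : x ≠ y := by
        rintro rfl
        exact lt_irrefl _ hlt
      norm_num [hne, hP] at hxy
  · rintro ⟨V, hV⟩
    refine ⟨fun x y => ?_, fun x y z hxy hyz => ?_⟩
    · by_contra! h
      obtain ⟨v, hv, hlt⟩ := ((hV x y).1 h.2).2
      exact absurd (((hV y x).1 h.1).1 v hv) (not_le.2 hlt)
    · obtain ⟨hyx, v, hv, hlt⟩ := (hV y x).1 hxy
      have hzy := ((hV z y).1 hyz).1
      exact (hV z x).2 ⟨fun w hw => (hyx w hw).trans (hzy w hw), v, hv,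
        lt_of_lt_of_le hlt (hzy v hv)⟩
end

section
/- Let Q be an asymmetric, transitive relation on a set X, and let {Q_α}_{α ∈ I} be a family of strict linear orders on X (asymmetric, transitive, trichotomous relations) such that Q = ⋂_{α ∈ I} Q_α and such that whenever x ≠ y, (x,y) ∉ Q and (y,x) ∉ Q, there exists α ∈ I with (x,y) ∈ Q_α. Then Q = (⋃_{α ∈ I} Q_α) ∩ (⋂_{α ∈ I} P_α), where P_α = {(x,y) ∈ X × X : (y,x) ∉ Q_α}. -/
universe u

/-- Key set identity in the proof of the Pareto embedding theorem: for a
Dushnik–Miller realization of `Q` by strict linear orders with incomparability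
witnesses, `Q = (⋃ α, Q_α) ∩ (⋂ α, P_α)` where `P_α` is the weak part of `Q_α`. -/
theorem pareto_realization_identity {X : Type u} (Q : Set (X × X))
    (hasym : ∀ x y : X, (x, y) ∈ Q → (y, x) ∉ Q)
    (htrans : ∀ x y z : X, (x, y) ∈ Q → (y, z) ∈ Q → (x, z) ∈ Q)
    (I : Type u) (Qa : I → Set (X × X))
    (hlin : ∀ α : I,
      (∀ x y : X, (x, y) ∈ Qa α → (y, x) ∉ Qa α) ∧
      (∀ x y z : X, (x, y) ∈ Qa α → (y, z) ∈ Qa α → (x, z) ∈ Qa α) ∧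
      (∀ x y : X, x ≠ y → (x, y) ∈ Qa α ∨ (y, x) ∈ Qa α))
    (hreal : Q = ⋂ α : I, Qa α)
    (hwitness : ∀ x y : X, x ≠ y → (x, y) ∉ Q → (y, x) ∉ Q → ∃ α : I, (x, y) ∈ Qa α) :
    Q = (⋃ α : I, Qa α) ∩ (⋂ α : I, {p : X × X | (p.2, p.1) ∉ Qa α}) := by
  have mem_iff : ∀ p : X × X, p ∈ Q ↔ ∀ α, p ∈ Qa α := fun p => by
    rw [hreal, Set.mem_iInter]
  ext ⟨x, y⟩
  simp only [Set.mem_inter_iff, Set.mem_iUnion, Set.mem_iInter, Set.mem_ofPred_eq]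
  constructor
  · intro h
    have hall := (mem_iff _).1 h
    refine ⟨?_, fun α => (hlin α).1 x y (hall α)⟩
    by_contra! hne
    exact hasym x y h ((mem_iff _).2 fun α => absurd (hall α) (hne α))
  · rintro ⟨⟨β, hβ⟩, hweak⟩
    have hxy : x ≠ y := by
      rintro rfl
      exact hweak β hβ
    exact (mem_iff _).2 fun α => ((hlin α).2.2 x y hxy).resolve_right (hweak α)
end
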